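/- Let p₁, …, p₆ be pairwise distinct primes greater than 3 such that for each i (indices taken cyclically modulo 6) there exists k_i ∈ ZMod p_i with k_i ≠ 0 for which the elliptic curve y² = x³ + k_i over F_{p_i} has exactly p_{i+1} points (including the point at infinity). If a, b are integers with p₁ = a² + 3b² and a ≡ 2 (mod 3), then a ≡ 6 (mod 7) and 7 divides b. -/

import Mathlib

/-- The number of `F_p`-rational points, including the point at infinity, of the elliptic curve
`y² = x³ + k` over `F_p`. -/
noncomputable def Npts (p : ℕ) (k : ZMod p) : ℕ :=
  Nat.card (WeierstrassCurve.Affine.Point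
    (WeierstrassCurve.toAffine ⟨0, 0, 0, 0, k⟩))

open Finset

theorem sum_eq_of_cube_invariant {G : Type*} [CommGroup G] [Fintype G] {g : G}
    (hg : ∀ x, x ∈ Subgroup.zpowers g) {n : ℕ} (hn : Fintype.card G = 3 * n) (f : G → ℤ)
    (hf : ∀ x m, f (x * m ^ 3) = f x) : ∑ x, f x = n * (f 1 + f g + f (g ^ 2)) := by
  classical
  have hord : orderOf g = 3 * n := by
    rw [orderOf_eq_card_of_forall_mem_zpowers hg, Nat.card_eq_fintype_card, hn]
  rw [← IsCyclic.image_range_orderOf hg, sum_image, hord]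
  · clear hord hn
    induction n with
    | zero => simp
    | succ n ih =>
      have h0 : f (g ^ (3 * n)) = f 1 := by rw [← hf 1 (g ^ n), one_mul, ← pow_mul, mul_comm]
      have h1 : f (g ^ (3 * n + 1)) = f g := by
        rw [← hf g (g ^ n), ← pow_mul, mul_comm n, pow_succ']
      have h2 : f (g ^ (3 * n + 2)) = f (g ^ 2) := by
        rw [← hf (g ^ 2) (g ^ n), ← pow_mul, mul_comm n, ← pow_add, add_comm]
      rw [show 3 * (n + 1) = 3 * n + 1 + 1 + 1 by ring, sum_range_succ, sum_range_succ,
        sum_range_succ, ih, h0, h1, h2]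
      push_cast
      ring
  · intro i hi j hj h
    exact pow_injOn_Iio_orderOf (by simpa using hi) (by simpa using hj) h

section CharSum

variable {F : Type*} [Field F] [Fintype F] [DecidableEq F]

/-- The character sum `∑ χ(x³ + k)`, where `χ` is the quadratic character; it is the negative of the
trace of Frobenius of the curve `y² = x³ + k`. -/
def cubicCharSum (k : F) : ℤ := ∑ x : F, quadraticChar F (x ^ 3 + k)

theorem sum_eq_zero_add_sum_units (f : F → ℤ) : ∑ x, f x = f 0 + ∑ u : Fˣ, f u := by
  rw [← add_sum_erase univ f (mem_univ 0)]
  congr 1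
  refine (sum_bij (fun (u : Fˣ) _ => (u : F)) ?_ ?_ ?_ ?_).symm
  · simp
  · intro u _ v _ h
    exact Units.ext h
  · intro b hb
    exact ⟨Units.mk0 b (by simpa using hb), mem_univ _, rfl⟩
  · simp

theorem cubicCharSum_mul_cube (k : F) (m : Fˣ) :
    cubicCharSum (k * m ^ 3) = quadraticChar F m * cubicCharSum k := by
  have h : quadraticChar F ((m : F) ^ 3) = quadraticChar F m := by
    rw [pow_succ, map_mul, quadraticChar_sq_one' m.ne_zero, one_mul]
  rw [cubicCharSum, cubicCharSum, mul_sum, ← h,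
    ← Equiv.sum_comp (Units.mulLeft m)]
  refine sum_congr rfl fun x _ => ?_
  rw [← map_mul]
  congr 1
  simp
  ring

theorem cubicCharSum_zero (hF : ringChar F ≠ 2) : cubicCharSum (0 : F) = 0 := by
  rw [← quadraticChar_sum_zero hF]
  refine sum_congr rfl fun x _ => ?_
  rcases eq_or_ne x 0 with rfl | hx
  · simp
  · rw [add_zero, pow_succ, map_mul, quadraticChar_sq_one' hx, one_mul]

theorem sum_quadraticChar_add (hF : ringChar F ≠ 2) (k : F) :
    ∑ x : F, quadraticChar F (x + k) = 0 := by
  rw [← quadraticChar_sum_zero hF]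
  exact Equiv.sum_comp (Equiv.addRight k) _

theorem sum_units_quadraticChar_mul_add (hF : ringChar F ≠ 2) {d : F} (hd : d ≠ 0) (k : F) :
    ∑ u : Fˣ, quadraticChar F (u * d + k) = -quadraticChar F k := by
  have h := sum_eq_zero_add_sum_units fun x : F => quadraticChar F (x * d + k)
  have h' := sum_quadraticChar_add hF k
  rw [← Equiv.sum_comp (Equiv.mulRight₀ d hd)] at h'
  change ∑ x : F, quadraticChar F (x * d + k) = 0 at h'
  rw [h', zero_mul, zero_add] at h
  linarith

theorem sum_quadraticChar_add_mul_add (hF : ringChar F ≠ 2) (a b : F) :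
    ∑ k : F, quadraticChar F (a + k) * quadraticChar F (b + k) =
      (if a = b then (Fintype.card F : ℤ) else 0) - 1 := by
  rw [← Equiv.sum_comp (Equiv.subRight a)]
  simp only [Equiv.subRight_apply, add_sub_cancel]
  rw [sum_eq_zero_add_sum_units, MulChar.map_zero, zero_mul, zero_add]
  have h : ∀ u : Fˣ, quadraticChar F (u : F) * quadraticChar F (b + (u - a)) =
      quadraticChar F ((u⁻¹ : Fˣ) * (b - a) + 1) := by
    intro u
    rw [← map_mul, show (u : F) * (b + (u - a)) = (u : F) ^ 2 * ((u⁻¹ : Fˣ) * (b - a) + 1) by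
      have := u.mul_inv
      push_cast at this ⊢
      field_simp
      ring, map_mul, quadraticChar_sq_one' u.ne_zero, one_mul]
  rw [sum_congr rfl fun u _ => h u, show ∑ u : Fˣ, quadraticChar F ((u⁻¹ : Fˣ) * (b - a) + 1) =
    ∑ u : Fˣ, quadraticChar F (u * (b - a) + 1) from Equiv.sum_comp (Equiv.inv Fˣ)
      fun u : Fˣ => quadraticChar F (u * (b - a) + 1)]
  split_ifs with hab
  · subst hab
    simp [Fintype.card_units, Nat.cast_sub Fintype.card_pos]
  · rw [sum_units_quadraticChar_mul_add hF (sub_ne_zero.2 (Ne.symm hab))]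
    simp

theorem sum_units_cubicCharSum_mul_sq (hF : ringChar F ≠ 2) (k : F) :
    ∑ c : Fˣ, cubicCharSum (k * (c : F) ^ 2) = 0 := by
  have h (c : Fˣ) : cubicCharSum (k * (c : F) ^ 2) = ∑ x : F, quadraticChar F (c * x ^ 3 + k) := by
    rw [cubicCharSum, ← Equiv.sum_comp (Units.mulLeft c)]
    refine sum_congr rfl fun x _ => ?_
    rw [← one_mul (quadraticChar F (c * x ^ 3 + k)), ← quadraticChar_sq_one' c.ne_zero, ← map_mul]
    congr 1
    simp
    ring
  rw [sum_congr rfl fun c _ => h c, sum_comm, sum_eq_zero_add_sum_units,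
    sum_congr rfl fun (u : Fˣ) _ =>
      sum_units_quadraticChar_mul_add hF (pow_ne_zero 3 u.ne_zero) k]
  simp

theorem sum_sum_ite_cube_eq_cube {n : ℕ} (hn : Fintype.card Fˣ = 3 * n) :
    ∑ x : F, ∑ y : F, (if x ^ 3 = y ^ 3 then (1 : ℤ) else 0) = 1 + 9 * n := by
  obtain ⟨g, hg⟩ := IsCyclic.exists_generator (α := Fˣ)
  have hord : orderOf g = 3 * n := by
    rw [orderOf_eq_card_of_forall_mem_zpowers hg, Nat.card_eq_fintype_card, hn]
  have hpos : 0 < 3 * n := hn ▸ Fintype.card_pos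
  have hprim : IsPrimitiveRoot (g ^ n) 3 :=
    (hord ▸ IsPrimitiveRoot.orderOf g).pow hpos (mul_comm 3 n)
  have hcard : ∑ y : F, (if y ^ 3 = 1 then (1 : ℤ) else 0) = 3 := by
    have := (IsPrimitiveRoot.coe_units_iff.2 hprim).card_nthRootsFinset
    rw [sum_boole]
    norm_cast
    refine Eq.trans ?_ this
    congr 1
    ext
    simp [Polynomial.mem_nthRootsFinset]
  have hu (u : Fˣ) : ∑ y : F, (if (u : F) ^ 3 = y ^ 3 then (1 : ℤ) else 0) = 3 := by
    rw [← hcard, ← Equiv.sum_comp (Units.mulLeft u)]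
    refine sum_congr rfl fun y _ => ?_
    congr 1
    rw [Units.mulLeft_apply, mul_pow, eq_comm (a := (u : F) ^ 3),
      mul_eq_left₀ (pow_ne_zero 3 u.ne_zero)]
  rw [sum_eq_zero_add_sum_units, sum_congr rfl fun u _ => hu u]
  have h0 : ∑ y : F, (if (0 : F) ^ 3 = y ^ 3 then (1 : ℤ) else 0) = 1 := by
    simp [eq_comm (a := (0 : F))]
  rw [h0]
  simp [hn]
  ring

theorem sum_sq_cubicCharSum (hF : ringChar F ≠ 2) {n : ℕ} (hn : Fintype.card Fˣ = 3 * n) :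
    ∑ k : F, cubicCharSum k ^ 2 = 6 * n * Fintype.card F := by
  have hq : (Fintype.card F : ℤ) = 3 * n + 1 := by
    rw [Fintype.card_units] at hn
    have := Fintype.card_pos (α := F)
    omega
  have h (k : F) : cubicCharSum k ^ 2 =
      ∑ x : F, ∑ y : F, quadraticChar F (x ^ 3 + k) * quadraticChar F (y ^ 3 + k) := by
    rw [sq, cubicCharSum, sum_mul_sum]
  rw [sum_congr rfl fun k _ => h k, sum_comm]
  have h' (x : F) : ∑ k : F, ∑ y : F, quadraticChar F (x ^ 3 + k) * quadraticChar F (y ^ 3 + k) =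
      ∑ y : F, ((Fintype.card F : ℤ) * (if x ^ 3 = y ^ 3 then (1 : ℤ) else 0) - 1) := by
    rw [sum_comm]
    refine sum_congr rfl fun y _ => ?_
    rw [sum_quadraticChar_add_mul_add hF, mul_ite, mul_one, mul_zero]
  rw [sum_congr rfl fun x _ => h' x]
  simp only [sum_sub_distrib, ← mul_sum, sum_sum_ite_cube_eq_cube hn]
  simp [hq]
  ring

theorem exists_sq_cubicCharSum_add (hF : ringChar F ≠ 2) {n : ℕ} (hn : Fintype.card Fˣ = 3 * n)
    {k : F} (hk : k ≠ 0) : ∃ r : ℤ, cubicCharSum k ^ 2 + 3 * r ^ 2 = 4 * Fintype.card F := by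
  obtain ⟨g, hg⟩ := IsCyclic.exists_generator (α := Fˣ)
  have hn0 : (n : ℤ) ≠ 0 := by
    have : 0 < Fintype.card Fˣ := Fintype.card_pos
    omega
  have h1 := sum_eq_of_cube_invariant hg hn (fun c => cubicCharSum (k * (c : F) ^ 2)) fun x m => by
    rw [show k * ((x * m ^ 3 : Fˣ) : F) ^ 2 = k * (x : F) ^ 2 * ((m ^ 2 : Fˣ) : F) ^ 3 by
      push_cast; ring, cubicCharSum_mul_cube, Units.val_pow_eq_pow_val,
      quadraticChar_sq_one' m.ne_zero, one_mul]
  have h2 := sum_eq_of_cube_invariant hg hn (fun c => cubicCharSum (k * (c : F)) ^ 2) fun x m => by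
    rw [show k * ((x * m ^ 3 : Fˣ) : F) = k * (x : F) * (m : F) ^ 3 by
      push_cast; ring, cubicCharSum_mul_cube, mul_pow, quadraticChar_sq_one m.ne_zero, one_mul]
  have h3 : ∑ c : Fˣ, cubicCharSum (k * (c : F)) ^ 2 = 6 * n * Fintype.card F := by
    have h := sum_eq_zero_add_sum_units fun x : F => cubicCharSum (k * x) ^ 2
    rw [mul_zero, cubicCharSum_zero hF, zero_pow two_ne_zero, zero_add] at h
    rw [← h, ← sum_sq_cubicCharSum hF hn]
    exact Equiv.sum_comp (Equiv.mulLeft₀ k hk) fun x => cubicCharSum x ^ 2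
  have h4 : cubicCharSum (k * ((g ^ 2 : Fˣ) : F) ^ 2) = quadraticChar F g * cubicCharSum (k * g) := by
    rw [← cubicCharSum_mul_cube]
    congr 1
    push_cast
    ring
  have h5 := quadraticChar_sq_one g.ne_zero
  rw [sum_units_cubicCharSum_mul_sq hF, h4] at h1
  rw [h3] at h2
  simp only [Units.val_one, one_pow, mul_one, Units.val_pow_eq_pow_val] at h1 h2
  generalize cubicCharSum (k * (g : F) ^ 2) = s at *
  generalize cubicCharSum (k * (g : F)) = t at *
  generalize cubicCharSum k = u at *
  generalize quadraticChar F g = e at *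
  replace h1 : u + s + e * t = 0 := by
    rcases mul_eq_zero.1 h1.symm with h | h
    · exact absurd h hn0
    · exact h
  replace h2 : 6 * (Fintype.card F : ℤ) = u ^ 2 + t ^ 2 + s ^ 2 :=
    mul_left_cancel₀ hn0 (by linarith)
  have h6 : (2 * s + u) ^ 2 + 3 * u ^ 2 = 12 * (Fintype.card F : ℤ) := by
    have : t ^ 2 = (u + s) ^ 2 := by
      linear_combination (-t ^ 2) * h5 - (u + s - e * t) * h1
    linear_combination -2 * h2 - 2 * this
  have h7 : (3 : ℤ) ∣ 2 * s + u :=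
    Int.prime_three.dvd_of_dvd_pow (n := 2) ⟨4 * Fintype.card F - u ^ 2, by linarith⟩
  obtain ⟨r, hr⟩ := h7
  exact ⟨r, by rw [hr] at h6; linarith⟩

theorem card_cubic_points (hF : ringChar F ≠ 2) (k : F) :
    (Nat.card {xy : F × F // xy.2 ^ 2 = xy.1 ^ 3 + k} : ℤ) =
      Fintype.card F + cubicCharSum k := by
  have h (x : F) : (Nat.card {y : F // y ^ 2 = x ^ 3 + k} : ℤ) =
      quadraticChar F (x ^ 3 + k) + 1 := by
    rw [← quadraticChar_card_sqrts hF, Set.toFinset_card, Nat.card_eq_fintype_card]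
    rfl
  have e : {xy : F × F // xy.2 ^ 2 = xy.1 ^ 3 + k} ≃ Σ x : F, {y : F // y ^ 2 = x ^ 3 + k} :=
    { toFun := fun P => ⟨P.1.1, P.1.2, P.2⟩
      invFun := fun P => ⟨(P.1, P.2.1), P.2.2⟩
      left_inv := fun _ => rfl
      right_inv := fun _ => rfl }
  rw [Nat.card_congr e, Nat.card_sigma, Nat.cast_sum, sum_congr rfl fun x _ => h x,
    sum_add_distrib, cubicCharSum]
  simp [add_comm]

end CharSum

theorem Npts_eq_add_cubicCharSum {p : ℕ} [Fact p.Prime] (hp : 3 < p) {k : ZMod p} (hk : k ≠ 0) :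
    (Npts p k : ℤ) = p + 1 + cubicCharSum k := by
  have hF : ringChar (ZMod p) ≠ 2 := by
    rw [ZMod.ringChar_zmod_n]
    omega
  have h2 : ((2 : ℕ) : ZMod p) ≠ 0 := fun h =>
    absurd (Nat.le_of_dvd two_pos ((ZMod.natCast_eq_zero_iff _ _).1 h)) (by omega)
  have h3 : ((3 : ℕ) : ZMod p) ≠ 0 := fun h =>
    absurd (Nat.le_of_dvd three_pos ((ZMod.natCast_eq_zero_iff _ _).1 h)) (by omega)
  let W : WeierstrassCurve.Affine (ZMod p) := WeierstrassCurve.toAffine ⟨0, 0, 0, 0, k⟩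
  have hΔ : W.Δ ≠ 0 := by
    have : W.Δ = -(((2 : ℕ) : ZMod p) ^ 4 * ((3 : ℕ) : ZMod p) ^ 3 * k ^ 2) := by
      simp only [W, WeierstrassCurve.Δ, WeierstrassCurve.b₂, WeierstrassCurve.b₄,
        WeierstrassCurve.b₆, WeierstrassCurve.b₈]
      push_cast
      ring
    rw [this]
    exact neg_ne_zero.2
      (mul_ne_zero (mul_ne_zero (pow_ne_zero _ h2) (pow_ne_zero _ h3)) (pow_ne_zero _ hk))
  have hW (x y : ZMod p) : W.Nonsingular x y ↔ y ^ 2 = x ^ 3 + k := by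
    rw [← WeierstrassCurve.Affine.equation_iff_nonsingular_of_Δ_ne_zero hΔ,
      WeierstrassCurve.Affine.equation_iff]
    simp [W]
  have e : W.Point ≃ Option {xy : ZMod p × ZMod p // xy.2 ^ 2 = xy.1 ^ 3 + k} :=
    (WeierstrassCurve.Affine.nonsingularPointEquiv W).trans
      (Equiv.subtypeEquivRight fun xy : ZMod p × ZMod p => hW xy.1 xy.2).optionCongr
  have hc := card_cubic_points hF k
  rw [ZMod.card] at hc
  rw [Npts, Nat.card_congr e, Finite.card_option]
  push_cast
  rw [hc]
  ring

theorem exists_unit_of_sq_add_three_mul_sq {p : ℕ} (hp : p.Prime) (h3 : 3 < p) {a b t r : ℤ}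
    (hab : (p : ℤ) = a ^ 2 + 3 * b ^ 2) (htr : t ^ 2 + 3 * r ^ 2 = 4 * p) :
    ∃ m n : ℤ, m ^ 2 + 3 * n ^ 2 = 4 ∧ t = m * a + 3 * n * b := by
  have hpZ : Prime (p : ℤ) := Nat.prime_iff_prime_int.1 hp
  have hp0 : (p : ℤ) ≠ 0 := hpZ.ne_zero
  have key (r : ℤ) (htr : t ^ 2 + 3 * r ^ 2 = 4 * p) (hd : (p : ℤ) ∣ t * a - 3 * r * b) :
      ∃ m n : ℤ, m ^ 2 + 3 * n ^ 2 = 4 ∧ t = m * a + 3 * n * b := by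
    obtain ⟨m, hm⟩ := hd
    have h1 : (p : ℤ) ∣ 3 * (t * b + r * a) ^ 2 :=
      ⟨4 * p - p * m ^ 2, by
        linear_combination (a ^ 2 + 3 * b ^ 2) * htr - 4 * (p : ℤ) * hab -
          (t * a - 3 * r * b + p * m) * hm⟩
    obtain ⟨n, hn⟩ : (p : ℤ) ∣ t * b + r * a := by
      rcases hpZ.dvd_or_dvd h1 with h | h
      · exact absurd (Int.le_of_dvd three_pos h) (by omega)
      · exact hpZ.dvd_of_dvd_pow h
    refine ⟨m, n, mul_left_cancel₀ (pow_ne_zero 2 hp0) ?_, mul_left_cancel₀ hp0 ?_⟩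
    · linear_combination (a ^ 2 + 3 * b ^ 2) * htr - 4 * (p : ℤ) * hab -
        (t * a - 3 * r * b + p * m) * hm - 3 * (t * b + r * a + p * n) * hn
    · linear_combination t * hab + a * hm + 3 * b * hn
  have hprod : (p : ℤ) ∣ (t * a - 3 * r * b) * (t * a - 3 * -r * b) :=
    ⟨t ^ 2 - 12 * b ^ 2, by linear_combination (-t ^ 2) * hab - 3 * b ^ 2 * htr⟩
  rcases hpZ.dvd_or_dvd hprod with h | h
  · exact key r htr h
  · exact key (-r) (by rw [neg_sq]; exact htr) h

theorem Npts_eq_of_prime {p q : ℕ} (hp : p.Prime) (hp3 : 3 < p) (hq : q.Prime) (hq3 : 3 < q)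
    {k : ZMod p} (hk : k ≠ 0) (hkq : Npts p k = q) {a b : ℤ}
    (hab : (p : ℤ) = a ^ 2 + 3 * b ^ 2) (ha : a % 3 = 2) :
    (q : ℤ) = p + 1 + a - 3 * b ∨ (q : ℤ) = p + 1 + a + 3 * b := by
  have := Fact.mk hp
  have hpmod : (p : ℤ) % 3 = 1 := by
    rw [hab, Int.add_mul_emod_self_left, sq, Int.mul_emod, ha]
    rfl
  have hF : ringChar (ZMod p) ≠ 2 := by
    rw [ZMod.ringChar_zmod_n]
    omega
  have hn : Fintype.card (ZMod p)ˣ = 3 * ((p - 1) / 3) := by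
    rw [ZMod.card_units]
    omega
  obtain ⟨r, hr⟩ := exists_sq_cubicCharSum_add hF hn hk
  rw [ZMod.card] at hr
  obtain ⟨m, n, hmn, ht⟩ := exists_unit_of_sq_add_three_mul_sq hp hp3 hab hr
  have hN := Npts_eq_add_cubicCharSum hp3 hk
  rw [hkq, ht] at hN
  have hp2 : (p : ℤ) % 2 = 1 := by
    have := hp.eq_two_or_odd
    omega
  have hq2 : (q : ℤ) % 2 = 1 := by
    have := hq.eq_two_or_odd
    omega
  have hqmod : (q : ℤ) % 3 ≠ 0 := fun h => by
    have := (Nat.prime_dvd_prime_iff_eq Nat.prime_three hq).1 (by omega)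
    omega
  have hm : -2 ≤ m ∧ m ≤ 2 := abs_le.1 (abs_le_of_sq_le_sq (by nlinarith) (by norm_num))
  have hn' : -1 ≤ n ∧ n ≤ 1 := abs_le.1 (abs_le_of_sq_le_sq (by nlinarith) (by norm_num))
  obtain ⟨hm1, hm2⟩ := hm
  obtain ⟨hn1, hn2⟩ := hn'
  interval_cases m <;> interval_cases n <;> omega

/-- Passing from `p` to `q = p + 1 + a - 3b` rotates `(a, b)` about `(-1, 0)`, and the
rotated pair represents `q`. -/
theorem exists_next_representation {p q s : ℕ} (hp : p.Prime) (hp3 : 3 < p) (hq : q.Prime)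
    (hq3 : 3 < q) (hs : s.Prime) (hs3 : 3 < s) {k : ZMod q} (hk : k ≠ 0) (hks : Npts q k = s)
    (hsp : s ≠ p) {a b : ℤ} (hab : (p : ℤ) = a ^ 2 + 3 * b ^ 2) (ha : a % 3 = 2)
    (hpq : (q : ℤ) = p + 1 + a - 3 * b) :
    ∃ a' b' : ℤ, 2 * a' = a + 3 * b - 1 ∧ 2 * b' = b - a - 1 ∧
      (q : ℤ) = a' ^ 2 + 3 * b' ^ 2 ∧ a' % 3 = 2 ∧ (s : ℤ) = q + 1 + a' - 3 * b' ∧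
      (p : ℤ) = q + 1 + a' + 3 * b' := by
  have hp2 := hp.eq_two_or_odd
  have hq2 := hq.eq_two_or_odd
  obtain ⟨a', ha'⟩ : ∃ a', 2 * a' = a + 3 * b - 1 := ⟨(a + 3 * b - 1) / 2, by omega⟩
  obtain ⟨b', hb'⟩ : ∃ b', 2 * b' = b - a - 1 := ⟨(b - a - 1) / 2, by omega⟩
  have hq' : (q : ℤ) = a' ^ 2 + 3 * b' ^ 2 := by
    have : 4 * (q : ℤ) = (2 * a') ^ 2 + 3 * (2 * b') ^ 2 := by
      rw [ha', hb', hpq, hab]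
      ring
    linarith
  have ha3 : a' % 3 = 2 := by omega
  refine ⟨a', b', ha', hb', hq', ha3, ?_, by omega⟩
  rcases Npts_eq_of_prime hq hq3 hs hs3 hk hks hq' ha3 with h | h <;> omega

theorem not_seven_dvd_of_neighbors_ne {p : ℕ} (hp : p.Prime) {a b : ℤ}
    (hab : (p : ℤ) = a ^ 2 + 3 * b ^ 2) (ha : a % 3 = 2) {q r : ℕ} (hq : (q : ℤ) = p + 1 + a - 3 * b)
    (hr : (r : ℤ) = p + 1 + a + 3 * b) (hpq : p ≠ q) (hpr : p ≠ r) : ¬ (7 : ℤ) ∣ p := by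
  intro h
  have hp7 : p = 7 := ((Nat.prime_dvd_prime_iff_eq (by norm_num) hp).1 (by omega)).symm
  subst hp7
  push_cast at hab
  have hA : -2 ≤ a ∧ a ≤ 2 := ⟨by nlinarith [sq_nonneg b], by nlinarith [sq_nonneg b]⟩
  have hB : -1 ≤ b ∧ b ≤ 1 := ⟨by nlinarith [sq_nonneg a], by nlinarith [sq_nonneg a]⟩
  obtain ⟨hA1, hA2⟩ := hA
  obtain ⟨hB1, hB2⟩ := hB
  interval_cases a <;> interval_cases b <;> omega

/-- The six primes are the norms of the points of the orbit of `(a, b)` under a rotation of order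
six about `(-1, 0)`. -/
theorem six_cycle_mod_seven {p : ℕ → ℕ}
    (hinj : ∀ i < 6, ∀ j < 6, p i = p j → i = j)
    (hprime : ∀ i < 6, (p i).Prime) (h3 : ∀ i < 6, 3 < p i)
    (hcyc : ∀ i < 6, ∃ k : ZMod (p i), k ≠ 0 ∧ Npts (p i) k = p ((i + 1) % 6))
    {a b : ℤ} (hab : (p 0 : ℤ) = a ^ 2 + 3 * b ^ 2) (ha : a % 3 = 2)
    (h01 : (p 1 : ℤ) = p 0 + 1 + a - 3 * b) :
    a % 7 = 6 ∧ (7 : ℤ) ∣ b := by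
  have hne (i j : ℕ) (hi : i < 6) (hj : j < 6) (hij : i ≠ j) : p i ≠ p j :=
    fun h => hij (hinj i hi j hj h)
  have next (i j l : ℕ) (hi : i < 6) (hj : j < 6) (hl : (j + 1) % 6 = l) (hl6 : l < 6)
      (hil : l ≠ i) {a b : ℤ} (hab : (p i : ℤ) = a ^ 2 + 3 * b ^ 2) (ha : a % 3 = 2)
      (h : (p j : ℤ) = p i + 1 + a - 3 * b) :
      ∃ a' b' : ℤ, 2 * a' = a + 3 * b - 1 ∧ 2 * b' = b - a - 1 ∧
        (p j : ℤ) = a' ^ 2 + 3 * b' ^ 2 ∧ a' % 3 = 2 ∧ (p l : ℤ) = p j + 1 + a' - 3 * b' ∧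
        (p i : ℤ) = p j + 1 + a' + 3 * b' := by
    obtain ⟨k, hk, hks⟩ := hcyc j hj
    rw [hl] at hks
    exact exists_next_representation (hprime i hi) (h3 i hi) (hprime j hj) (h3 j hj)
      (hprime l hl6) (h3 l hl6) hk hks (hne l i hl6 hi hil) hab ha h
  obtain ⟨a1, b1, ha1, hb1, hab1, ham1, h12, h10⟩ :=
    next 0 1 2 (by simp) (by simp) rfl (by simp) (by simp) hab ha h01
  obtain ⟨a2, b2, ha2, hb2, hab2, ham2, h23, h21⟩ :=
    next 1 2 3 (by simp) (by simp) rfl (by simp) (by simp) hab1 ham1 h12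
  obtain ⟨a3, b3, ha3, hb3, hab3, ham3, h34, h32⟩ :=
    next 2 3 4 (by simp) (by simp) rfl (by simp) (by simp) hab2 ham2 h23
  obtain ⟨a4, b4, ha4, hb4, hab4, ham4, h45, h43⟩ :=
    next 3 4 5 (by simp) (by simp) rfl (by simp) (by simp) hab3 ham3 h34
  obtain ⟨a5, b5, ha5, hb5, hab5, ham5, h50, h54⟩ :=
    next 4 5 0 (by simp) (by simp) rfl (by simp) (by simp) hab4 ham4 h45
  have e2 : (p 2 : ℤ) = p 0 + 3 + 3 * a - 3 * b := by linarith
  have e3 : (p 3 : ℤ) = p 0 + 4 + 4 * a := by linarith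
  have e4 : (p 4 : ℤ) = p 0 + 3 + 3 * a + 3 * b := by linarith
  have h05 : (p 5 : ℤ) = p 0 + 1 + a + 3 * b := by linarith
  have d0 := not_seven_dvd_of_neighbors_ne (hprime 0 (by simp)) hab ha h01 h05
    (hne 0 1 (by simp) (by simp) (by simp)) (hne 0 5 (by simp) (by simp) (by simp))
  have d1 := not_seven_dvd_of_neighbors_ne (hprime 1 (by simp)) hab1 ham1 h12 h10
    (hne 1 2 (by simp) (by simp) (by simp)) (hne 1 0 (by simp) (by simp) (by simp))
  have d2 := not_seven_dvd_of_neighbors_ne (hprime 2 (by simp)) hab2 ham2 h23 h21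
    (hne 2 3 (by simp) (by simp) (by simp)) (hne 2 1 (by simp) (by simp) (by simp))
  have d3 := not_seven_dvd_of_neighbors_ne (hprime 3 (by simp)) hab3 ham3 h34 h32
    (hne 3 4 (by simp) (by simp) (by simp)) (hne 3 2 (by simp) (by simp) (by simp))
  have d4 := not_seven_dvd_of_neighbors_ne (hprime 4 (by simp)) hab4 ham4 h45 h43
    (hne 4 5 (by simp) (by simp) (by simp)) (hne 4 3 (by simp) (by simp) (by simp))
  have d5 := not_seven_dvd_of_neighbors_ne (hprime 5 (by simp)) hab5 ham5 h50 h54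
    (hne 5 0 (by simp) (by simp) (by simp)) (hne 5 4 (by simp) (by simp) (by simp))
  rw [h01] at d1
  rw [e2] at d2
  rw [e3] at d3
  rw [e4] at d4
  rw [h05] at d5
  clear * - hab d0 d1 d2 d3 d4 d5
  have hmod : (p 0 : ℤ) % 7 = ((a % 7) ^ 2 + 3 * (b % 7) ^ 2) % 7 := by
    rw [hab]
    simp [Int.add_emod, Int.mul_emod, pow_two]
  have hA := Int.emod_nonneg a (show (7 : ℤ) ≠ 0 by norm_num)
  have hA' := Int.emod_lt_of_pos a (show (0 : ℤ) < 7 by norm_num)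
  have hB := Int.emod_nonneg b (show (7 : ℤ) ≠ 0 by norm_num)
  have hB' := Int.emod_lt_of_pos b (show (0 : ℤ) < 7 by norm_num)
  generalize hx : a % 7 = x at *
  generalize hy : b % 7 = y at *
  interval_cases x <;> interval_cases y <;> omega

/-- Theorem 3.9: if `p₁ = a² + 3b²` (with `a ≡ −1 (mod 3)`) is part of a proper elliptic
`6`-cycle over `d = 3`, then `a ≡ −1 (mod 7)` and `7 ∣ b`. -/
theorem stmt_13 (p : ℕ → ℕ)
    (hinj : ∀ i < 6, ∀ j < 6, p i = p j → i = j)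
    (hprime : ∀ i < 6, (p i).Prime) (h3 : ∀ i < 6, 3 < p i)
    (hcyc : ∀ i < 6, ∃ k : ZMod (p i), k ≠ 0 ∧ Npts (p i) k = p ((i + 1) % 6))
    (a b : ℤ) (hab : (p 0 : ℤ) = a ^ 2 + 3 * b ^ 2) (ha : a % 3 = 2) :
    a % 7 = 6 ∧ (7 : ℤ) ∣ b := by
  obtain ⟨k, hk, hkq⟩ := hcyc 0 (by simp)
  rcases Npts_eq_of_prime (hprime 0 (by simp)) (h3 0 (by simp)) (hprime 1 (by simp))
    (h3 1 (by simp)) hk hkq hab ha with h | h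
  · exact six_cycle_mod_seven hinj hprime h3 hcyc hab ha h
  · have := six_cycle_mod_seven hinj hprime h3 hcyc (b := -b) (by rw [neg_sq]; exact hab) ha
      (by rw [h]; ring)
    rwa [dvd_neg] at this
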